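/- arXiv:2301.06686 — 3 statements merged into one kernel-verified Lean document; each statement's English description precedes it below -/
import Mathlib

section
/- Let ν ∈ ℝ, let s ∈ ℂ with Re s > 0, let ρ₁ > ρ₂ > 0 and τ > 0. Then |K_ν(s ρ₁ + τ)| ≤ e^{-τ (1 - ρ₂²/ρ₁²)} · |K_ν(s ρ₂)|. -/
open MeasureTheory

/-- The modified Bessel function of the second kind,
`K_ν(z) = ∫₀^∞ e^{-z cosh t} cosh(ν t) dt`, for `Re z > 0`. -/
noncomputable def besselK (ν : ℝ) (z : ℂ) : ℂ :=
  ∫ t in Set.Ioi (0 : ℝ), Complex.exp (-z * Real.cosh t) * (Real.cosh (ν * t) : ℂ)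

lemma bk_sq_le_cosh (t : ℝ) : t ^ 2 / 2 ≤ Real.cosh t := by
  have h1 : Real.cosh t = 2 * Real.sinh (t / 2) ^ 2 + 1 := by
    have h := Real.cosh_two_mul (t / 2)
    have h' := Real.cosh_sq (t / 2)
    rw [show 2 * (t / 2) = t by ring] at h
    linarith
  have h2 : (t / 2) ^ 2 ≤ Real.sinh (t / 2) ^ 2 := by
    rw [sq_le_sq, Real.abs_sinh]
    exact Real.self_le_sinh_iff.2 (abs_nonneg _)
  nlinarith

lemma bk_integrable_real (x ν : ℝ) (hx : 0 < x) :
    Integrable (fun t : ℝ => Real.exp (-x * Real.cosh t + ν * t)) := by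
  have h := (integrable_cexp_quadratic (b := ((x / 2 : ℝ) : ℂ)) (by simpa using hx) (ν : ℂ) 0).norm
  refine h.mono' (by fun_prop) (Filter.Eventually.of_forall fun t => ?_)
  rw [Complex.norm_exp, Real.norm_eq_abs, Real.abs_exp, Real.exp_le_exp]
  have e : (-((x / 2 : ℝ) : ℂ) * (t : ℂ) ^ 2 + (ν : ℂ) * t + 0)
      = ((-(x / 2) * t ^ 2 + ν * t : ℝ) : ℂ) := by push_cast; ring
  rw [e, Complex.ofReal_re]
  nlinarith [mul_le_mul_of_nonneg_left (bk_sq_le_cosh t) hx.le]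

lemma bk_integrable (z : ℂ) (ν : ℝ) (hz : 0 < z.re) :
    Integrable (fun t : ℝ => Complex.exp (-z * (Real.cosh t : ℝ) + (ν * t : ℝ))) := by
  refine (bk_integrable_real z.re ν hz).mono' (by fun_prop)
    (Filter.Eventually.of_forall fun t => ?_)
  rw [Complex.norm_exp, Complex.add_re, Complex.re_mul_ofReal, Complex.ofReal_re, Complex.neg_re]

/-- whole-line form -/
lemma bk_eq (ν : ℝ) (z : ℂ) (hz : 0 < z.re) :
    ∫ t : ℝ, Complex.exp (-z * (Real.cosh t : ℝ) + (ν * t : ℝ)) = 2 * besselK ν z := by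
  set f : ℝ → ℂ := fun t => Complex.exp (-z * (Real.cosh t : ℝ) + (ν * t : ℝ)) with hf
  have hi : Integrable f := bk_integrable z ν hz
  have h1 : ∫ t, f t = (∫ t in Set.Iic (0:ℝ), f t) + ∫ t in Set.Ioi (0:ℝ), f t :=
    (intervalIntegral.integral_Iic_add_Ioi hi.integrableOn hi.integrableOn).symm
  have h2 : ∫ t in Set.Iic (0:ℝ), f t = ∫ t in Set.Ioi (0:ℝ), f (-t) := by
    rw [integral_comp_neg_Ioi]; simp
  change ∫ t, f t = _
  rw [h1, h2, ← integral_add hi.comp_neg.integrableOn hi.integrableOn, besselK,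
    ← integral_const_mul]
  congr 1
  ext t
  simp only [hf, Real.cosh_neg, Complex.exp_add]
  rw [Complex.ofReal_cosh (ν * t), Complex.cosh]
  push_cast
  ring_nf

lemma bk_cosh_add (R b φ : ℝ) : -(R : ℂ) * Complex.cosh (b + φ * Complex.I) =
    -((R * Real.cos φ * Real.cosh b : ℝ) : ℂ)
      - ((R * Real.sin φ * Real.sinh b : ℝ) : ℂ) * Complex.I := by
  rw [Complex.cosh_add, Complex.cosh_mul_I, Complex.sinh_mul_I]
  push_cast
  ring

lemma bk_norm_exp (R b φ : ℝ) : ‖Complex.exp (-(R : ℂ) * Complex.cosh (b + φ * Complex.I))‖ =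
    Real.exp (-(R * Real.cos φ) * Real.cosh b) := by
  rw [Complex.norm_exp, bk_cosh_add, Complex.sub_re, Complex.re_ofReal_mul, Complex.neg_re,
    Complex.ofReal_re, Complex.I_re]
  ring_nf

lemma bk_norm_sinh (b φ : ℝ) : ‖Complex.sinh (b + φ * Complex.I)‖ ≤ Real.cosh b := by
  have h : ‖Complex.sinh (b + φ * Complex.I)‖ ^ 2 ≤ Real.cosh b ^ 2 := by
    rw [Complex.sinh_add, Complex.cosh_mul_I, Complex.sinh_mul_I]
    rw [show Complex.sinh (b:ℂ) * Complex.cos φ + Complex.cosh b * (Complex.sin φ * Complex.I) =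
      ((Real.sinh b * Real.cos φ : ℝ) : ℂ) + ((Real.cosh b * Real.sin φ : ℝ) : ℂ) * Complex.I by
        push_cast; ring]
    rw [← Complex.normSq_eq_norm_sq, Complex.normSq_add_mul_I]
    have := Real.cosh_sq b
    have := Real.sin_sq_add_cos_sq φ
    nlinarith [sq_nonneg (Real.cos φ)]
  exact le_of_sq_le_sq h (Real.cosh_pos b).le

lemma bk_bound_int (R c : ℝ) (hc : 0 < c) :
    Integrable (fun b : ℝ => R * (Real.cosh b * Real.exp (-c * Real.cosh b))) := by
  refine Integrable.const_mul ?_ R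
  have h := ((bk_integrable_real c 1 hc).add (bk_integrable_real c (-1) hc)).div_const 2
  refine h.congr (Filter.Eventually.of_forall fun b => ?_)
  simp only [Pi.add_apply]
  rw [Real.cosh_eq b, Real.exp_add, Real.exp_add]
  ring_nf

lemma bk_hasDeriv (R φ : ℝ) (hR : 0 < R) (hφ : φ ∈ Set.Ioo (-(Real.pi / 2)) (Real.pi / 2)) :
    HasDerivAt (fun φ : ℝ => ∫ b : ℝ, Complex.exp (-(R : ℂ) * Complex.cosh (b + φ * Complex.I)))
      0 φ := by
  have hcos : 0 < Real.cos φ := Real.cos_pos_of_mem_Ioo hφ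
  set c := Real.cos φ / 2 with hc
  have hc0 : 0 < c := by positivity
  set F' : ℝ → ℝ → ℂ := fun φ b =>
    Complex.exp (-(R : ℂ) * Complex.cosh (b + φ * Complex.I)) *
      (-(R : ℂ) * (Complex.sinh (b + φ * Complex.I) * Complex.I)) with hF'
  have hs : {x : ℝ | c < Real.cos x} ∈ nhds φ :=
    (isOpen_lt continuous_const Real.continuous_cos).mem_nhds (by
      show c < Real.cos φ
      rw [hc]; linarith)
  have hint : Integrable (fun b : ℝ => Complex.exp (-(R : ℂ) * Complex.cosh (b + φ * Complex.I))) := by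
    refine (bk_integrable_real (R * Real.cos φ) 0 (by positivity)).mono' (by fun_prop)
      (Filter.Eventually.of_forall fun b => ?_)
    rw [bk_norm_exp]; simp
  obtain ⟨hi, hd⟩ := hasDerivAt_integral_of_dominated_loc_of_deriv_le (μ := volume) (𝕜 := ℝ)
    (F := fun (φ b : ℝ) => Complex.exp (-(R : ℂ) * Complex.cosh (b + φ * Complex.I)))
    (F' := F') (x₀ := φ) (s := {x : ℝ | c < Real.cos x})
    (bound := fun b => R * (Real.cosh b * Real.exp (-(R * c) * Real.cosh b))) hs
    (Filter.Eventually.of_forall fun x => by fun_prop) hint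
    (by simp only [hF']; fun_prop)
    (Filter.Eventually.of_forall fun b x hx => by
      simp only [hF']
      rw [norm_mul, bk_norm_exp, norm_mul, norm_mul, norm_neg, Complex.norm_I, Complex.norm_real,
        Real.norm_of_nonneg hR.le, mul_one]
      have h1 := bk_norm_sinh b x
      have h2 : Real.exp (-(R * Real.cos x) * Real.cosh b) ≤
          Real.exp (-(R * c) * Real.cosh b) := by
        rw [Real.exp_le_exp]
        have : R * c ≤ R * Real.cos x := mul_le_mul_of_nonneg_left (le_of_lt hx) hR.le
        nlinarith [Real.cosh_pos b]
      calc _ ≤ Real.exp (-(R * c) * Real.cosh b) * (R * Real.cosh b) := by gcongr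
        _ = _ := by ring)
    (bk_bound_int R (R * c) (by positivity))
    (Filter.Eventually.of_forall fun b x _ => by
      have h1 : HasDerivAt (fun x : ℝ => (b : ℂ) + (x : ℂ) * Complex.I) Complex.I x := by
        have := ((Complex.ofRealCLM.hasDerivAt (x := x)).mul_const Complex.I).const_add (b : ℂ)
        simpa using this
      exact (((Complex.hasDerivAt_cosh _).comp x h1).const_mul (-(R : ℂ))).cexp)
  have hz : ∫ b, F' φ b = 0 := by
    refine integral_eq_zero_of_hasDerivAt_of_integrable
      (f := fun b : ℝ => Complex.I * Complex.exp (-(R : ℂ) * Complex.cosh (b + φ * Complex.I)))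
      (fun b => ?_) hi (hint.const_mul _)
    have h1 : HasDerivAt (fun b : ℝ => (b : ℂ) + (φ : ℂ) * Complex.I) 1 b := by
      have := (Complex.ofRealCLM.hasDerivAt (x := b)).add_const ((φ : ℂ) * Complex.I)
      simpa using this
    have h2 := ((((Complex.hasDerivAt_cosh _).comp b h1).const_mul (-(R : ℂ))).cexp).const_mul Complex.I
    have h3 : F' φ b = Complex.I *
        (Complex.exp (-(R : ℂ) * Complex.cosh (b + φ * Complex.I)) *
          (-(R : ℂ) * (Complex.sinh (b + φ * Complex.I) * 1))) := by
      simp only [hF']; ring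
    rw [h3]
    exact h2
  rwa [hz] at hd

lemma bk_rotate (R φ : ℝ) (hR : 0 < R) (hφ : φ ∈ Set.Ioo (-(Real.pi / 2)) (Real.pi / 2)) :
    ∫ b : ℝ, Complex.exp (-(R : ℂ) * Complex.cosh (b + φ * Complex.I)) =
      ((∫ b : ℝ, Real.exp (-R * Real.cosh b) : ℝ) : ℂ) := by
  have h := IsOpen.is_const_of_deriv_eq_zero (𝕜 := ℝ)
    (f := fun φ : ℝ => ∫ b : ℝ, Complex.exp (-(R : ℂ) * Complex.cosh (b + φ * Complex.I)))
    isOpen_Ioo isPreconnected_Ioo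
    (fun x hx => (bk_hasDeriv R x hR hx).differentiableAt.differentiableWithinAt)
    (fun x hx => (bk_hasDeriv R x hR hx).deriv) hφ
    (show (0 : ℝ) ∈ Set.Ioo (-(Real.pi / 2)) (Real.pi / 2) by
      constructor <;> linarith [Real.pi_pos])
  rw [h, ← integral_complex_ofReal]
  congr 1
  ext b
  push_cast
  simp

lemma bk_rotate' (X Y : ℝ) (hX : 0 < X) :
    ∫ b : ℝ, Complex.exp (-((X * Real.cosh b : ℝ) : ℂ) - ((Y * Real.sinh b : ℝ) : ℂ) * Complex.I) =
      ((∫ b : ℝ, Real.exp (-Real.sqrt (X ^ 2 + Y ^ 2) * Real.cosh b) : ℝ) : ℂ) := by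
  set w : ℂ := ⟨X, Y⟩ with hw
  have hw0 : w ≠ 0 := fun h => by
    have : w.re = 0 := by rw [h]; simp
    simp [hw] at this; linarith
  have hn : ‖w‖ = Real.sqrt (X ^ 2 + Y ^ 2) := by
    rw [Complex.norm_eq_sqrt_sq_add_sq]
  have hR : 0 < ‖w‖ := norm_pos_iff.2 hw0
  have ha : w.arg ∈ Set.Ioo (-(Real.pi / 2)) (Real.pi / 2) := by
    have := Complex.abs_arg_lt_pi_div_two_iff.2 (Or.inl (show 0 < w.re from hX))
    exact abs_lt.1 this
  rw [← hn, ← bk_rotate ‖w‖ w.arg hR ha]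
  congr 1
  ext b
  rw [bk_cosh_add, Complex.norm_mul_cos_arg, Complex.norm_mul_sin_arg]

lemma bk_mp : MeasurePreserving (fun p : ℝ × ℝ => (p.2 - p.1 / 2, p.2 + p.1 / 2))
    (volume.prod volume) (volume.prod volume) := by
  have h1 : MeasurePreserving (fun p : ℝ × ℝ => (id p.1, p.2 - p.1 / 2))
      (volume.prod volume) (volume.prod volume) :=
    (MeasurePreserving.id volume).skew_product (g := fun a c : ℝ => c - a / 2)
      (by simp only [Function.uncurry_def]; fun_prop) (Filter.Eventually.of_forall fun a =>
        (measurePreserving_sub_right volume (a / 2)).map_eq)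
  have h2 := (measurePreserving_prod_add (volume : Measure ℝ) (volume : Measure ℝ)).comp
    ((Measure.measurePreserving_swap (μ := (volume : Measure ℝ)) (ν := (volume : Measure ℝ))).comp h1)
  convert h2 using 1
  ext p <;> simp
  ring

noncomputable def bkJ (r : ℝ) : ℝ := ∫ b : ℝ, Real.exp (-(2 * r) * Real.cosh b)

noncomputable def bkR (z : ℂ) (q : ℝ) : ℝ :=
  Real.sqrt ((z.re * Real.cosh q) ^ 2 + (z.im * Real.sinh q) ^ 2)

lemma bk_sq (ν : ℝ) (z : ℂ) (hz : 0 < z.re) :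
    Integrable (fun q : ℝ => Real.exp (2 * ν * q) * bkJ (bkR z q)) ∧
    2 * ‖besselK ν z‖ ^ 2 = ∫ q : ℝ, Real.exp (2 * ν * q) * bkJ (bkR z q) := by
  set f : ℝ → ℂ := fun t => Complex.exp (-z * (Real.cosh t : ℝ) + (ν * t : ℝ)) with hf
  have hi : Integrable f := bk_integrable z ν hz
  set g : ℝ → ℂ := fun t => (starRingEnd ℂ) (f t) with hg
  have hgi : Integrable g := (Complex.conjLIE.integrable_comp_iff (φ := f)).2 hi
  have hprod : Integrable (fun p : ℝ × ℝ => g p.1 * f p.2) (volume.prod volume) := hgi.mul_prod hi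
  have hcomp : Integrable (fun p : ℝ × ℝ => g (p.2 - p.1 / 2) * f (p.2 + p.1 / 2))
      (volume.prod volume) := bk_mp.integrable_comp_of_integrable hprod
  have hI : ∫ p, g (p.2 - p.1 / 2) * f (p.2 + p.1 / 2) ∂(volume.prod volume : Measure (ℝ × ℝ))
      = (∫ t, g t) * ∫ t, f t := by
    rw [← integral_prod_mul]
    conv_rhs => rw [← bk_mp.map_eq]
    rw [integral_map bk_mp.aemeasurable (by rw [bk_mp.map_eq]; exact hprod.aestronglyMeasurable)]
  have hinner : ∀ q : ℝ, ∫ p : ℝ, g (q - p / 2) * f (q + p / 2) =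
      ((2 * (Real.exp (2 * ν * q) * bkJ (bkR z q)) : ℝ) : ℂ) := by
    intro q
    have h1 := Measure.integral_comp_div (fun p => g (q - p) * f (q + p)) 2
    rw [h1]
    have h2 : ∀ p : ℝ, g (q - p) * f (q + p) = ((Real.exp (2 * ν * q) : ℝ) : ℂ) *
        Complex.exp (-((2 * (z.re * Real.cosh q) * Real.cosh p : ℝ) : ℂ)
          - ((2 * (z.im * Real.sinh q) * Real.sinh p : ℝ) : ℂ) * Complex.I) := by
      intro p
      simp only [hg, hf]
      rw [← Complex.exp_conj, Complex.ofReal_exp, ← Complex.exp_add, ← Complex.exp_add]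
      congr 1
      rw [Real.cosh_add, Real.cosh_sub]
      apply Complex.ext <;> simp <;> ring
    simp only [h2]
    rw [integral_const_mul, bk_rotate' _ _ (by have := Real.cosh_pos q; positivity)]
    have h3 : Real.sqrt ((2 * (z.re * Real.cosh q)) ^ 2 + (2 * (z.im * Real.sinh q)) ^ 2)
        = 2 * bkR z q := by
      rw [bkR, show (2 * (z.re * Real.cosh q)) ^ 2 + (2 * (z.im * Real.sinh q)) ^ 2 =
        2 ^ 2 * ((z.re * Real.cosh q) ^ 2 + (z.im * Real.sinh q) ^ 2) by ring,
        Real.sqrt_mul (by norm_num), Real.sqrt_sq (by norm_num)]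
    rw [h3, ← bkJ]
    simp
  have hint := hcomp.integral_prod_right
  simp only [hinner] at hint
  have hint' : Integrable (fun q : ℝ => 2 * (Real.exp (2 * ν * q) * bkJ (bkR z q))) := by
    have := hint.re
    refine this.congr (Filter.Eventually.of_forall fun q => ?_)
    exact Complex.ofReal_re _
  have hfin : Integrable (fun q : ℝ => Real.exp (2 * ν * q) * bkJ (bkR z q)) := by
    have := hint'.const_mul (1 / 2)
    refine this.congr (Filter.Eventually.of_forall fun q => ?_)
    simp only; ring
  refine ⟨hfin, ?_⟩
  rw [integral_prod_symm _ hcomp] at hI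
  simp only [hinner] at hI
  rw [integral_complex_ofReal, hg, integral_conj, integral_const_mul, bk_eq ν z hz,
    Complex.conj_mul'] at hI
  rw [norm_mul] at hI
  have hI' : (2 * ∫ q : ℝ, Real.exp (2 * ν * q) * bkJ (bkR z q)) = (‖(2 : ℂ)‖ * ‖besselK ν z‖) ^ 2 := by
    exact_mod_cast hI
  rw [Complex.norm_ofNat] at hI'
  linarith

lemma bkJ_le (r₁ r₂ d : ℝ) (hr : 0 < r₂) (hd : 0 ≤ d) (h : r₂ + d ≤ r₁) :
    bkJ r₁ ≤ Real.exp (-(2 * d)) * bkJ r₂ := by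
  rw [bkJ, bkJ, ← integral_const_mul]
  have hi : ∀ r : ℝ, 0 < r → Integrable (fun b : ℝ => Real.exp (-(2 * r) * Real.cosh b)) := by
    intro r hr
    simpa using bk_integrable_real (2 * r) 0 (by positivity)
  refine integral_mono (hi r₁ (by linarith)) ((hi r₂ hr).const_mul _) fun b => ?_
  simp only
  rw [← Real.exp_add, Real.exp_le_exp]
  have := Real.one_le_cosh b
  nlinarith [mul_le_mul_of_nonneg_right h (by linarith : (0:ℝ) ≤ Real.cosh b),
    mul_le_mul_of_nonneg_left this hd]

lemma bkR_le (s : ℂ) (hs : 0 < s.re) (ρ₁ ρ₂ τ : ℝ)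
    (hρ₂ : 0 < ρ₂) (hρ : ρ₂ < ρ₁) (hτ : 0 < τ) (q : ℝ) :
    bkR (s * ρ₂) q + τ * (1 - ρ₂ ^ 2 / ρ₁ ^ 2) ≤ bkR (s * ρ₁ + τ) q := by
  have hρ₁ : 0 < ρ₁ := hρ₂.trans hρ
  obtain ⟨k, hk⟩ : ∃ k, k = ρ₂ / ρ₁ := ⟨_, rfl⟩
  have hk0 : 0 < k := by rw [hk]; positivity
  have hk1 : k < 1 := by rw [hk, div_lt_one hρ₁]; exact hρ
  have hρk : ρ₂ = k * ρ₁ := by rw [hk]; field_simp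
  rw [show ρ₂ ^ 2 / ρ₁ ^ 2 = k ^ 2 by rw [hk, div_pow]]
  have hc := Real.one_le_cosh q
  set c := Real.cosh q
  set A := s.re * c with hA
  set B := s.im * Real.sinh q with hB
  have hA0 : 0 < A := by positivity
  have hr2 : 0 ≤ A ^ 2 + B ^ 2 := by positivity
  set r := Real.sqrt (A ^ 2 + B ^ 2) with hr
  have hrr : r ^ 2 = A ^ 2 + B ^ 2 := Real.sq_sqrt hr2
  have hr0 : 0 ≤ r := Real.sqrt_nonneg _
  have e2 : bkR (s * ρ₂) q = ρ₂ * r := by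
    rw [bkR, show ((s * ρ₂).re * Real.cosh q) ^ 2 + ((s * ρ₂).im * Real.sinh q) ^ 2 =
      ρ₂ ^ 2 * (A ^ 2 + B ^ 2) by simp [hA, hB, c]; ring, Real.sqrt_mul (by positivity),
      Real.sqrt_sq hρ₂.le]
  have e1 : bkR (s * ρ₁ + τ) q = Real.sqrt ((ρ₁ * A + τ * c) ^ 2 + (ρ₁ * B) ^ 2) := by
    rw [bkR]; congr 1; simp [hA, hB, c]; ring
  rw [e1, e2]
  apply Real.le_sqrt_of_sq_le
  have h1 : ρ₁ ^ 2 * r ^ 2 + τ ^ 2 ≤ (ρ₁ * A + τ * c) ^ 2 + (ρ₁ * B) ^ 2 := by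
    rw [hrr]
    have : 0 ≤ ρ₁ * A * (τ * c) := by positivity
    have : τ ^ 2 * 1 ≤ τ ^ 2 * c ^ 2 := by gcongr; nlinarith
    nlinarith
  refine le_trans ?_ h1
  rw [hρk]
  have hk2 : 0 ≤ 1 - k ^ 2 := by nlinarith
  -- (k u + m τ)² ≤ u² + τ² with m = 1 - k²
  have h2 : 0 ≤ (1 - k ^ 2) * (ρ₁ * r - k * τ) ^ 2 := by positivity
  have h3 : 0 ≤ (1 - k ^ 2) * (k ^ 2 * τ ^ 2) := by positivity
  have h4 : 0 ≤ k ^ 2 * τ ^ 2 := by positivity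
  nlinarith

/-- Paper's Lemma C.2 (Chen–Wu): for `ν ∈ ℝ`, `Re s > 0`, `ρ₁ > ρ₂ > 0` and `τ > 0`,
`|K_ν(sρ₁ + τ)| ≤ e^{-τ(1 - ρ₂²/ρ₁²)} |K_ν(sρ₂)|`. -/
theorem besselK_decay (ν : ℝ) (s : ℂ) (hs : 0 < s.re) (ρ₁ ρ₂ τ : ℝ)
    (hρ₂ : 0 < ρ₂) (hρ : ρ₂ < ρ₁) (hτ : 0 < τ) :
    ‖besselK ν (s * ρ₁ + τ)‖ ≤
      Real.exp (-τ * (1 - ρ₂ ^ 2 / ρ₁ ^ 2)) * ‖besselK ν (s * ρ₂)‖ := by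
  have hρ₁ : 0 < ρ₁ := hρ₂.trans hρ
  have hz1 : 0 < (s * ρ₁ + τ).re := by simp; positivity
  have hz2 : 0 < (s * ρ₂).re := by simp; positivity
  obtain ⟨i1, k1⟩ := bk_sq ν _ hz1
  obtain ⟨i2, k2⟩ := bk_sq ν _ hz2
  set d := τ * (1 - ρ₂ ^ 2 / ρ₁ ^ 2) with hd
  have hd0 : 0 ≤ d := by
    have : ρ₂ ^ 2 / ρ₁ ^ 2 ≤ 1 := by
      rw [div_le_one (by positivity)]; gcongr
    rw [hd]; exact mul_nonneg hτ.le (by linarith)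
  have key : 2 * ‖besselK ν (s * ρ₁ + τ)‖ ^ 2 ≤
      Real.exp (-(2 * d)) * (2 * ‖besselK ν (s * ρ₂)‖ ^ 2) := by
    rw [k1, k2, ← integral_const_mul]
    refine integral_mono i1 (i2.const_mul _) fun q => ?_
    simp only
    have hr : 0 < bkR (s * ρ₂) q := by
      have := Real.cosh_pos q
      rw [bkR]; apply Real.sqrt_pos.2; positivity
    have := bkJ_le _ _ d hr hd0 (bkR_le s hs ρ₁ ρ₂ τ hρ₂ hρ hτ q)
    calc _ ≤ Real.exp (2 * ν * q) * (Real.exp (-(2 * d)) * bkJ (bkR (s * ρ₂) q)) := by gcongr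
      _ = _ := by ring
  rw [show -τ * (1 - ρ₂ ^ 2 / ρ₁ ^ 2) = -d by rw [hd]; ring]
  refine le_of_sq_le_sq ?_ (by positivity)
  rw [mul_pow, ← Real.exp_nat_mul]
  have : ((2 : ℕ) : ℝ) * -d = -(2 * d) := by push_cast; ring
  rw [this]
  linarith
end

section
/- Let s₁ > 0 and let g : ℝ → ℂ be smooth with compact support contained in (0,∞). For s₂ ∈ ℝ write s = s₁ + i s₂ and g_L(s) = ∫₀^∞ e^{-st} g(t) dt. Let m : ℝ → ℂ be measurable, suppose there exist constants C > 0 and N ∈ ℕ with |m(s₂)| ≤ C(1+|s₂|)^N for all s₂, and suppose Re( m(s₂) · (s₁ - i s₂) ) ≤ 0 for all s₂ ∈ ℝ. Define h(t) = (1/(2π)) e^{s₁ t} ∫_ℝ e^{i s₂ t} m(s₂) g_L(s₁ + i s₂) ds₂ (the integral converges absolutely since g_L(s₁ + i·) decays rapidly). Then Re ∫₀^∞ e^{-2 s₁ t} h(t) · conj(g'(t)) dt ≤ 0. -/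
open MeasureTheory

/-- Laplace transform of a test function, as an integral over the whole line. -/
lemma msn_decay (s₁ : ℝ) (g : ℝ → ℂ)
    (hg_smooth : ContDiff ℝ (⊤ : ℕ∞) g) (hg_cpt : HasCompactSupport g) :
    ∃ ψ : SchwartzMap ℝ ℂ, ∀ x : ℝ,
      ∫ u : ℝ, Complex.exp (-((s₁ : ℂ) + x * Complex.I) * u) * g u = ψ x := by
  have h1 : ContDiff ℝ (⊤ : ℕ∞) (fun u : ℝ => Complex.exp (-(s₁ : ℂ) * u) * g u) := by
    refine ContDiff.mul (ContDiff.cexp (contDiff_const.mul Complex.ofRealCLM.contDiff)) hg_smooth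
  have h2 : HasCompactSupport (fun u : ℝ => Complex.exp (-(s₁ : ℂ) * u) * g u) :=
    hg_cpt.mul_left
  let φ : SchwartzMap ℝ ℂ := h2.toSchwartzMap h1
  let e : ℝ ≃L[ℝ] ℝ := ContinuousLinearEquiv.smulLeft (Units.mk0 ((2 * Real.pi)⁻¹) (by positivity))
  refine ⟨SchwartzMap.compCLMOfContinuousLinearEquiv ℝ e (FourierTransform.fourier φ), fun x => ?_⟩
  have he : e x = (2 * Real.pi)⁻¹ * x := rfl
  simp only [SchwartzMap.compCLMOfContinuousLinearEquiv_apply, Function.comp, he,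
    SchwartzMap.fourier_coe]
  rw [Real.fourier_real_eq_integral_exp_smul]
  congr 1
  ext u
  have hφ : φ u = Complex.exp (-(s₁ : ℂ) * u) * g u := rfl
  rw [hφ, smul_eq_mul, ← mul_assoc, ← Complex.exp_add]
  congr 2
  push_cast
  have : (Real.pi : ℂ) ≠ 0 := by exact_mod_cast Real.pi_ne_zero
  field_simp
  ring

lemma msn_integrable (ψ : SchwartzMap ℝ ℂ) (m : ℝ → ℂ) (hm_meas : Measurable m)
    (C : ℝ) (N : ℕ) (hC : 0 < C)
    (hm_bd : ∀ s₂ : ℝ, ‖m s₂‖ ≤ C * (1 + |s₂|) ^ N) :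
    Integrable (fun x => m x * ψ x) := by
  have h0 := (ψ.integrable_pow_mul volume 0).add (ψ.integrable_pow_mul volume N)
  refine (h0.const_mul (C * 2 ^ (N - 1))).mono'
    (hm_meas.aestronglyMeasurable.mul ψ.continuous.aestronglyMeasurable) ?_
  filter_upwards with x
  have h1 : (1 + |x|) ^ N ≤ 2 ^ (N - 1) * (1 ^ N + |x| ^ N) :=
    add_pow_le zero_le_one (abs_nonneg x) N
  rw [norm_mul]
  simp only [Pi.add_apply, Real.norm_eq_abs, pow_zero, one_pow] at *
  calc ‖m x‖ * ‖ψ x‖ ≤ (C * (2 ^ (N - 1) * (1 + |x| ^ N))) * ‖ψ x‖ := by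
        gcongr
        exact (hm_bd x).trans (by gcongr)
    _ = _ := by ring

lemma msn_parts (s : ℂ) (g : ℝ → ℂ)
    (hg_smooth : ContDiff ℝ (⊤ : ℕ∞) g) (hg_cpt : HasCompactSupport g) :
    ∫ u : ℝ, Complex.exp (-s * u) * deriv g u = s * ∫ u : ℝ, Complex.exp (-s * u) * g u := by
  have hc : Continuous (fun u : ℝ => Complex.exp (-s * u)) := by fun_prop
  have hd : Continuous (deriv g) := hg_smooth.continuous_deriv (by simp)
  have he : ∀ u : ℝ, HasDerivAt (fun u : ℝ => Complex.exp (-s * u))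
      (Complex.exp (-s * u) * -s) u := by
    intro u
    have : HasDerivAt (fun u : ℝ => -s * (u : ℂ)) (-s) u := by
      simpa using (Complex.ofRealCLM.hasDerivAt (x := u)).const_mul (-s)
    exact this.cexp
  have := integral_mul_deriv_eq_deriv_mul_of_integrable
    (u := fun u : ℝ => Complex.exp (-s * u)) (v := g) (v' := deriv g)
    (fun x _ => he x) (fun x _ => (hg_smooth.differentiable (by simp) x).hasDerivAt)
    ((hc.mul hd).integrable_of_hasCompactSupport hg_cpt.deriv.mul_left)
    (((hc.mul continuous_const).mul hg_smooth.continuous).integrable_of_hasCompactSupport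
      hg_cpt.mul_left)
    ((hc.mul hg_smooth.continuous).integrable_of_hasCompactSupport hg_cpt.mul_left)
  rw [this, ← integral_neg, ← integral_const_mul]
  congr 1
  ext u
  ring

/-- Single-mode scalar-multiplier core of the paper's Lemma 2.4: if the symbol `m` has at
most polynomial growth and satisfies `Re (m(s₂) (s₁ - i s₂)) ≤ 0` on the line
`Re s = s₁ > 0`, and `h` is defined from the smooth, compactly supported (in `(0,∞)`)
datum `g` by `h(t) = (1/2π) e^{s₁ t} ∫_ℝ e^{i s₂ t} m(s₂) g_L(s₁ + i s₂) ds₂`, where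
`g_L(s) = ∫₀^∞ e^{-s u} g(u) du`, then
`Re ∫₀^∞ e^{-2 s₁ t} h(t) conj(g'(t)) dt ≤ 0`. -/
theorem multiplier_sign_nonpos (s₁ : ℝ) (hs₁ : 0 < s₁) (g : ℝ → ℂ)
    (hg_smooth : ContDiff ℝ (⊤ : ℕ∞) g) (hg_cpt : HasCompactSupport g)
    (hg_supp : tsupport g ⊆ Set.Ioi (0 : ℝ))
    (m : ℝ → ℂ) (hm_meas : Measurable m)
    (C : ℝ) (N : ℕ) (hC : 0 < C)
    (hm_bd : ∀ s₂ : ℝ, ‖m s₂‖ ≤ C * (1 + |s₂|) ^ N)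
    (hm_sign : ∀ s₂ : ℝ, (m s₂ * ((s₁ : ℂ) - s₂ * Complex.I)).re ≤ 0)
    (h : ℝ → ℂ)
    (hdef : ∀ t : ℝ, h t =
      (1 / (2 * Real.pi) : ℝ) • (Real.exp (s₁ * t) •
        ∫ s₂ : ℝ, Complex.exp (s₂ * t * Complex.I) * m s₂ *
          ∫ u in Set.Ioi (0 : ℝ), Complex.exp (-((s₁ : ℂ) + s₂ * Complex.I) * u) * g u)) :
    (∫ t in Set.Ioi (0 : ℝ),
        Real.exp (-2 * s₁ * t) • (h t * (starRingEnd ℂ) (deriv g t))).re ≤ 0 := by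
  have hz : ∀ t : ℝ, t ∉ Set.Ioi (0 : ℝ) → g t = 0 := fun t ht =>
    image_eq_zero_of_notMem_tsupport fun h' => ht (hg_supp h')
  have hz' : ∀ t : ℝ, t ∉ Set.Ioi (0 : ℝ) → deriv g t = 0 := fun t ht =>
    image_eq_zero_of_notMem_tsupport fun h' => ht (hg_supp (tsupport_deriv_subset h'))
  obtain ⟨ψ, hψ⟩ := msn_decay s₁ g hg_smooth hg_cpt
  have hG : ∀ x : ℝ, (∫ u in Set.Ioi (0 : ℝ),
      Complex.exp (-((s₁ : ℂ) + x * Complex.I) * u) * g u) = ψ x := by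
    intro x
    rw [← hψ x]
    exact setIntegral_eq_integral_of_forall_compl_eq_zero fun t ht => by rw [hz t ht, mul_zero]
  have hF := msn_integrable ψ m hm_meas C N hC hm_bd
  have hd : Continuous (deriv g) := hg_smooth.continuous_deriv (by simp)
  let k : ℝ → ℂ := fun t => (Real.exp (-s₁ * t) : ℂ) * (starRingEnd ℂ) (deriv g t)
  have hk : Integrable k := by
    apply Continuous.integrable_of_hasCompactSupport
    · exact (by fun_prop : Continuous fun t : ℝ => (Real.exp (-s₁ * t) : ℂ)).mul
        (Complex.continuous_conj.comp hd)
    · exact HasCompactSupport.mul_left (hg_cpt.deriv.comp_left (map_zero _))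
  have hprod : Integrable (Function.uncurry fun t x : ℝ =>
      Complex.exp (x * t * Complex.I) * (k t * (m x * ψ x))) (volume.prod volume) := by
    refine (hk.mul_prod hF).bdd_mul (c := 1) ?_ ?_
    · exact (by fun_prop : Continuous fun p : ℝ × ℝ =>
        Complex.exp (p.2 * p.1 * Complex.I)).aestronglyMeasurable
    · filter_upwards with p
      rw [← Complex.ofReal_mul, Complex.norm_exp_ofReal_mul_I]
  have key : (∫ t in Set.Ioi (0 : ℝ),
        Real.exp (-2 * s₁ * t) • (h t * (starRingEnd ℂ) (deriv g t))) =
      (1 / (2 * Real.pi) : ℝ) • ∫ x : ℝ, (m x * ((s₁ : ℂ) - x * Complex.I)) *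
        ((‖ψ x‖ ^ 2 : ℝ) : ℂ) := by
    rw [setIntegral_eq_integral_of_forall_compl_eq_zero fun t ht => by
      rw [hz' t ht, map_zero, mul_zero, smul_zero]]
    have e1 : ∀ t : ℝ, Real.exp (-2 * s₁ * t) • (h t * (starRingEnd ℂ) (deriv g t)) =
        (1 / (2 * Real.pi) : ℝ) • ∫ x : ℝ,
          Complex.exp (x * t * Complex.I) * (k t * (m x * ψ x)) := by
      intro t
      have e2 : ∀ x : ℝ, Complex.exp (x * t * Complex.I) * (k t * (m x * ψ x)) =
          k t * (Complex.exp (x * t * Complex.I) * m x * ψ x) := fun x => by ring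
      simp_rw [e2, integral_const_mul, hdef t, hG, k]
      have e3 : Real.exp (-s₁ * t) = Real.exp (-2 * s₁ * t) * Real.exp (s₁ * t) := by
        rw [← Real.exp_add]; congr 1; ring
      rw [e3]
      simp only [Complex.real_smul]
      push_cast
      ring
    simp_rw [e1]
    rw [integral_smul, integral_integral_swap hprod]
    congr 2
    ext x
    have e4 : ∀ t : ℝ, Complex.exp (x * t * Complex.I) * (k t * (m x * ψ x)) =
        (m x * ψ x) * (starRingEnd ℂ)
          (Complex.exp (-((s₁ : ℂ) + x * Complex.I) * t) * deriv g t) := by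
      intro t
      simp only [k, map_mul, ← Complex.exp_conj, map_neg, map_add, Complex.conj_ofReal,
        Complex.conj_I, Complex.ofReal_exp]
      have e5 : Complex.exp (-((s₁ : ℂ) + x * -Complex.I) * t) =
          Complex.exp (x * t * Complex.I) * Complex.exp (((-s₁ * t : ℝ) : ℂ)) := by
        rw [← Complex.exp_add]; congr 1; push_cast; ring
      rw [e5]
      ring
    simp_rw [e4]
    rw [integral_const_mul, integral_conj, msn_parts _ g hg_smooth hg_cpt, hψ x]
    have e6 : ((‖ψ x‖ ^ 2 : ℝ) : ℂ) = ψ x * (starRingEnd ℂ) (ψ x) := by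
      rw [Complex.mul_conj, Complex.normSq_eq_norm_sq]
    rw [e6]
    simp only [map_mul, map_add, Complex.conj_ofReal, Complex.conj_I]
    ring
  rw [key, Complex.smul_re, smul_eq_mul]
  refine mul_nonpos_of_nonneg_of_nonpos (by positivity) ?_
  by_cases hi : Integrable (fun x : ℝ => (m x * ((s₁ : ℂ) - x * Complex.I)) *
        ((‖ψ x‖ ^ 2 : ℝ) : ℂ))
  · have := integral_re hi
    simp only [RCLike.re_to_complex] at this
    rw [← this]
    refine integral_nonpos fun x => ?_
    simp only [Complex.re_mul_ofReal]
    exact mul_nonpos_of_nonpos_of_nonneg (hm_sign x) (by positivity)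
  · rw [integral_undef hi]; simp
end

section
/- Let s₁ > 0, R > 0, and let N ≥ 1 be an integer. For each n with 1 ≤ n ≤ N let g_n : ℝ → ℂ be smooth with compact support contained in (0,∞), and write g_{n,L}(s) = ∫₀^∞ e^{-st} g_n(t) dt. For each n define h_n(t) = (1/(2π)) e^{s₁ t} ∫_ℝ e^{i s₂ t} (s₁ + i s₂) · (K_n'((s₁+i s₂)R)/K_n((s₁+i s₂)R)) · g_{n,L}(s₁ + i s₂) ds₂. Then Re Σ_{n=1}^N ∫₀^∞ e^{-2 s₁ t} h_n(t) · conj(g_n'(t)) dt ≤ 0. -/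
open MeasureTheory

/-- The derivative of the modified Bessel function of the second kind,
`K_ν'(z) = -∫₀^∞ e^{-z cosh t} cosh t cosh(ν t) dt`, for `Re z > 0`. -/
noncomputable def besselK' (ν : ℝ) (z : ℂ) : ℂ :=
  -∫ t in Set.Ioi (0 : ℝ),
      Complex.exp (-z * Real.cosh t) * (Real.cosh t : ℂ) * (Real.cosh (ν * t) : ℂ)

section
open Filter Topology

noncomputable def momA (k : ℕ) (ν : ℝ) (z : ℂ) : ℂ :=
  ∫ t in Set.Ioi (0 : ℝ),
    Complex.exp (-z * Real.cosh t) * (Real.cosh t : ℂ) ^ k * (Real.cosh (ν * t) : ℂ)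

lemma cosh_ge_sq {t : ℝ} (ht : 0 ≤ t) : t ^ 2 / 4 ≤ Real.cosh t := by
  rw [Real.cosh_eq]
  have h1 := Real.quadratic_le_exp_of_nonneg ht
  have h2 := Real.exp_pos (-t)
  nlinarith

lemma cosh_le_exp' {t : ℝ} (ht : 0 ≤ t) : Real.cosh t ≤ Real.exp t := by
  rw [Real.cosh_eq]
  have : Real.exp (-t) ≤ Real.exp t := Real.exp_le_exp.2 (by linarith)
  linarith

lemma real_bound (k : ℕ) {ν a t : ℝ} (hν : 0 ≤ ν) (ha : 0 < a) (ht : 0 ≤ t) :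
    Real.exp (-a * Real.cosh t) * Real.cosh t ^ k * Real.cosh (ν * t) ≤
      Real.exp ((k + ν + 1) ^ 2 / a) * Real.exp (-1 * t) := by
  have h1 : Real.cosh t ^ k ≤ Real.exp (k * t) := by
    rw [Real.exp_nat_mul]
    exact pow_le_pow_left₀ (Real.cosh_pos t).le (cosh_le_exp' ht) k
  have h2 := cosh_le_exp' (mul_nonneg hν ht)
  calc _ ≤ Real.exp (-a * Real.cosh t) * Real.exp (k * t) * Real.exp (ν * t) := by
        gcongr
    _ ≤ _ := by
        rw [← Real.exp_add, ← Real.exp_add, ← Real.exp_add]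
        apply Real.exp_le_exp.2
        set M : ℝ := k + ν + 1 with hM
        have h3 := cosh_ge_sq ht
        have h4 : M * t ≤ a * (t ^ 2 / 4) + M ^ 2 / a := by
          have : a * (t ^ 2 / 4) + M ^ 2 / a - M * t = (a * t / 2 - M) ^ 2 / a := by
            field_simp; ring
          have h5 : 0 ≤ (a * t / 2 - M) ^ 2 / a := by positivity
          linarith
        have h6 := mul_le_mul_of_nonneg_left h3 ha.le
        have : (k + ν + 1) * t = M * t := by rw [hM]
        nlinarith

lemma real_integrable (k : ℕ) {ν a : ℝ} (hν : 0 ≤ ν) (ha : 0 < a) :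
    IntegrableOn (fun t : ℝ => Real.exp (-a * Real.cosh t) * Real.cosh t ^ k *
      Real.cosh (ν * t)) (Set.Ioi 0) := by
  apply integrable_of_isBigO_exp_neg one_pos (by fun_prop)
  apply Asymptotics.IsBigO.of_bound (Real.exp ((k + ν + 1) ^ 2 / a))
  filter_upwards [eventually_ge_atTop 0] with t ht
  have := real_bound k hν ha ht
  have h0 := Real.cosh_pos t
  have h1 := Real.cosh_pos (ν * t)
  rw [Real.norm_of_nonneg (by positivity), Real.norm_of_nonneg (by positivity)]
  exact this

lemma norm_integrand (k : ℕ) (ν : ℝ) (z : ℂ) (t : ℝ) :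
    ‖Complex.exp (-z * Real.cosh t) * (Real.cosh t : ℂ) ^ k * (Real.cosh (ν * t) : ℂ)‖ =
    Real.exp (-z.re * Real.cosh t) * Real.cosh t ^ k * Real.cosh (ν * t) := by
  have h0 := Real.cosh_pos t
  have h1 := Real.cosh_pos (ν * t)
  rw [norm_mul, norm_mul, norm_pow, Complex.norm_exp, Complex.norm_real, Complex.norm_real,
    Real.norm_of_nonneg h0.le, Real.norm_of_nonneg h1.le, Complex.re_mul_ofReal, Complex.neg_re]

lemma cont_integrand (k : ℕ) (ν : ℝ) (z : ℂ) :
    Continuous (fun t : ℝ =>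
      Complex.exp (-z * Real.cosh t) * (Real.cosh t : ℂ) ^ k * (Real.cosh (ν * t) : ℂ)) := by
  fun_prop

lemma integrand_integrable (k : ℕ) {ν : ℝ} {z : ℂ} (hν : 0 ≤ ν) (hz : 0 < z.re) :
    IntegrableOn (fun t : ℝ =>
      Complex.exp (-z * Real.cosh t) * (Real.cosh t : ℂ) ^ k * (Real.cosh (ν * t) : ℂ))
      (Set.Ioi 0) := by
  apply Integrable.mono' (real_integrable k hν hz) (cont_integrand k ν z).aestronglyMeasurable
  filter_upwards with t
  exact (norm_integrand k ν z t).le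

lemma momA_deriv (k : ℕ) {ν : ℝ} (hν : 0 ≤ ν) {s : ℂ} (hs : 0 < s.re) {r : ℝ} (hr : 0 < r) :
    HasDerivAt (fun x : ℝ => momA k ν (s * x)) (-s * momA (k + 1) ν (s * r)) r := by
  have key := hasDerivAt_integral_of_dominated_loc_of_deriv_le
    (μ := volume.restrict (Set.Ioi (0 : ℝ))) (𝕜 := ℝ) (x₀ := r) (s := Set.Ioi (r / 2))
    (F := fun (x : ℝ) (t : ℝ) => Complex.exp (-(s * x) * Real.cosh t) * (Real.cosh t : ℂ) ^ k *
      (Real.cosh (ν * t) : ℂ))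
    (F' := fun (x : ℝ) (t : ℝ) => -s * (Complex.exp (-(s * x) * Real.cosh t) *
      (Real.cosh t : ℂ) ^ (k + 1) * (Real.cosh (ν * t) : ℂ)))
    (bound := fun t => ‖s‖ * (Real.exp (-(s.re * (r / 2)) * Real.cosh t) *
      Real.cosh t ^ (k + 1) * Real.cosh (ν * t)))
    (Ioi_mem_nhds (by linarith))
    (Eventually.of_forall fun x => (cont_integrand k ν _).aestronglyMeasurable)
    (integrand_integrable k hν (by simpa using mul_pos hs hr))
    ((continuous_const.mul (cont_integrand (k + 1) ν _)).aestronglyMeasurable)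
    ?_ ((real_integrable (k + 1) hν (by positivity)).const_mul _) ?_
  · have h2 := key.2
    rw [integral_const_mul] at h2
    exact h2
  · filter_upwards with t x hx
    rw [norm_mul, norm_neg, norm_integrand]
    have h0 := Real.cosh_pos t
    have h1 := Real.cosh_pos (ν * t)
    have hx' : r / 2 < x := hx
    simp only [Complex.re_mul_ofReal]
    gcongr
  · filter_upwards with t x hx
    have h1 : HasDerivAt (fun x : ℝ => -(s * (x : ℂ)) * (Real.cosh t : ℂ))
        (-(s * 1) * (Real.cosh t : ℂ)) x :=
      (((Complex.ofRealCLM.hasDerivAt (x := x)).const_mul s).neg).mul_const _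
    have h2 := ((h1.cexp).mul_const ((Real.cosh t : ℂ) ^ k)).mul_const (Real.cosh (ν * t) : ℂ)
    refine h2.congr_deriv ?_
    ring

lemma exp_neg_tendsto (C : ℝ) : Tendsto (fun t : ℝ => C * Real.exp (-1 * t)) atTop (𝓝 0) := by
  have : Tendsto (fun t : ℝ => Real.exp (-t)) atTop (𝓝 0) := Real.tendsto_exp_neg_atTop_nhds_zero
  simpa using this.const_mul C

lemma abs_sinh_le (t : ℝ) : |Real.sinh t| ≤ Real.cosh t := by
  rw [Real.sinh_eq, Real.cosh_eq, abs_le]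
  have := Real.exp_pos t
  have := Real.exp_pos (-t)
  constructor <;> linarith

lemma momA_ode {ν : ℝ} (hν : 0 ≤ ν) {z : ℂ} (hz : 0 < z.re) :
    z ^ 2 * momA 2 ν z = z * momA 1 ν z + (z ^ 2 + ν ^ 2) * momA 0 ν z := by
  set e : ℕ → ℝ → ℂ := fun k t =>
    Complex.exp (-z * Real.cosh t) * (Real.cosh t : ℂ) ^ k * (Real.cosh (ν * t) : ℂ) with he
  have i0 : Integrable (e 0) (volume.restrict (Set.Ioi 0)) := integrand_integrable 0 hν hz
  have i1 : Integrable (e 1) (volume.restrict (Set.Ioi 0)) := integrand_integrable 1 hν hz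
  have i2 : Integrable (e 2) (volume.restrict (Set.Ioi 0)) := integrand_integrable 2 hν hz
  have j21 : Integrable (fun t => -z ^ 2 * e 2 t + z * e 1 t) (volume.restrict (Set.Ioi 0)) :=
    (i2.const_mul _).add (i1.const_mul _)
  have j0 : Integrable (fun t => (z ^ 2 + ν ^ 2) * e 0 t) (volume.restrict (Set.Ioi 0)) :=
    i0.const_mul _
  have j : IntegrableOn (fun t => (-z ^ 2 * e 2 t + z * e 1 t) + (z ^ 2 + ν ^ 2) * e 0 t)
    (Set.Ioi 0) := Integrable.add j21 j0
  have key := integral_Ioi_of_hasDerivAt_of_tendsto' (a := 0) (m := (0 : ℂ))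
    (f := fun t : ℝ => Complex.exp (-z * Real.cosh t) *
      (z * (Real.sinh t : ℂ) * (Real.cosh (ν * t) : ℂ) + ν * (Real.sinh (ν * t) : ℂ)))
    (f' := fun t : ℝ => (-z ^ 2 * e 2 t + z * e 1 t) + (z ^ 2 + ν ^ 2) * e 0 t)
    ?_ j ?_
  · rw [integral_add j21 j0,
      integral_add (i2.const_mul _) (i1.const_mul _), integral_const_mul, integral_const_mul,
      integral_const_mul] at key
    simp only [Real.sinh_zero, mul_zero, Complex.ofReal_zero, zero_mul, add_zero, sub_zero] at key
    unfold momA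
    simp only [he] at key
    linear_combination -key
  · intro t _
    have hc : HasDerivAt (fun t : ℝ => (Real.cosh t : ℂ)) (Real.sinh t : ℂ) t :=
      (Real.hasDerivAt_cosh t).ofReal_comp
    have hs : HasDerivAt (fun t : ℝ => (Real.sinh t : ℂ)) (Real.cosh t : ℂ) t :=
      (Real.hasDerivAt_sinh t).ofReal_comp
    have hl : HasDerivAt (fun t : ℝ => ν * t) (ν * 1) t := (hasDerivAt_id t).const_mul ν
    have hcn : HasDerivAt (fun t : ℝ => (Real.cosh (ν * t) : ℂ))
        ((Real.sinh (ν * t) * (ν * 1) : ℝ) : ℂ) t := (hl.cosh).ofReal_comp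
    have hsn : HasDerivAt (fun t : ℝ => (Real.sinh (ν * t) : ℂ))
        ((Real.cosh (ν * t) * (ν * 1) : ℝ) : ℂ) t := (hl.sinh).ofReal_comp
    have h := ((hc.const_mul (-z)).cexp).mul
      (((hs.const_mul z).mul hcn).add (hsn.const_mul (ν : ℂ)))
    refine HasDerivAt.congr_deriv h ?_
    have hsq : (Real.cosh t : ℂ) ^ 2 = (Real.sinh t : ℂ) ^ 2 + 1 := by
      exact_mod_cast Real.cosh_sq t
    simp only [he, Pi.add_apply, Pi.mul_apply]
    push_cast at hsq ⊢
    simp only [pow_one, pow_zero, hsq]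
    ring
  · apply squeeze_zero_norm' (a := fun t => ‖z‖ * (Real.exp (((1 : ℕ) + ν + 1) ^ 2 / z.re) *
      Real.exp (-1 * t)) + ν * (Real.exp (((0 : ℕ) + ν + 1) ^ 2 / z.re) * Real.exp (-1 * t)))
    · filter_upwards [eventually_ge_atTop 0] with t ht
      have b1 := real_bound 1 hν hz ht
      have b0 := real_bound 0 hν hz ht
      have h0 := Real.cosh_pos t
      have h1 := Real.cosh_pos (ν * t)
      rw [norm_mul, Complex.norm_exp, Complex.re_mul_ofReal, Complex.neg_re]
      have hn : ‖z * (Real.sinh t : ℂ) * (Real.cosh (ν * t) : ℂ) + ν * (Real.sinh (ν * t) : ℂ)‖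
          ≤ ‖z‖ * Real.cosh t * Real.cosh (ν * t) + ν * Real.cosh (ν * t) := by
        refine (norm_add_le _ _).trans ?_
        simp only [norm_mul, Complex.norm_real, Real.norm_eq_abs]
        rw [abs_of_nonneg h1.le, abs_of_nonneg hν]
        gcongr
        · exact abs_sinh_le t
        · exact abs_sinh_le _
      calc _ ≤ Real.exp (-z.re * Real.cosh t) *
            (‖z‖ * Real.cosh t * Real.cosh (ν * t) + ν * Real.cosh (ν * t)) := by gcongr
        _ = ‖z‖ * (Real.exp (-z.re * Real.cosh t) * Real.cosh t ^ 1 * Real.cosh (ν * t)) +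
            ν * (Real.exp (-z.re * Real.cosh t) * Real.cosh t ^ 0 * Real.cosh (ν * t)) := by ring
        _ ≤ _ := by gcongr
    · simpa using ((exp_neg_tendsto _).const_mul ‖z‖).add ((exp_neg_tendsto _).const_mul ν)

lemma momA_decay (k : ℕ) {ν : ℝ} (hν : 0 ≤ ν) {s : ℂ} (hs : 0 < s.re) :
    ∃ C, 0 ≤ C ∧ ∀ r : ℝ, 1 ≤ r → ‖momA k ν (s * r)‖ ≤ C * Real.exp (-s.re * r) := by
  refine ⟨Real.exp s.re * ∫ t in Set.Ioi (0 : ℝ), (Real.exp (-s.re * Real.cosh t) *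
    Real.cosh t ^ k * Real.cosh (ν * t)), ?_, ?_⟩
  · apply mul_nonneg (Real.exp_pos _).le
    apply integral_nonneg
    intro t
    have h0 := Real.cosh_pos t
    have h1 := Real.cosh_pos (ν * t)
    simp only [Pi.zero_apply]
    positivity
  · intro r hr
    unfold momA
    rw [mul_right_comm, ← integral_const_mul]
    apply norm_integral_le_of_norm_le ((real_integrable k hν hs).const_mul _)
    filter_upwards with t
    rw [norm_integrand, Complex.re_mul_ofReal]
    have h0 := Real.cosh_pos t
    have h1 := Real.cosh_pos (ν * t)
    have h2 := Real.one_le_cosh t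
    rw [← mul_assoc, ← mul_assoc, ← Real.exp_add, ← Real.exp_add]
    gcongr
    nlinarith [mul_nonneg (mul_nonneg hs.le (sub_nonneg.2 hr)) (sub_nonneg.2 h2)]

lemma momA_sign {ν : ℝ} (hν : 0 ≤ ν) {s : ℂ} (hs : 0 < s.re) {R : ℝ} (hR : 0 < R) :
    0 ≤ (momA 1 ν (s * R) * (starRingEnd ℂ) (momA 0 ν (s * R))).re := by
  set P : ℝ → ℝ := fun r =>
    r * (momA 1 ν (s * r) * (starRingEnd ℂ) (momA 0 ν (s * r))).re with hP
  have hd : ∀ r : ℝ, 0 < r → ∃ d ≤ 0, HasDerivAt P d r := by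
    intro r hr
    have h0 := momA_deriv 0 hν hs hr
    have h1 := momA_deriv 1 hν hs hr
    have h0c : HasDerivAt (fun x : ℝ => (starRingEnd ℂ) (momA 0 ν (s * x)))
      ((starRingEnd ℂ) (-s * momA (0 + 1) ν (s * r))) r := h0.star
    have hm := h1.mul h0c
    have hre := (Complex.reCLM.hasFDerivAt.comp_hasDerivAt r hm)
    have hPd := (hasDerivAt_id r).mul hre
    refine ⟨_, ?_, hPd⟩
    have hz : 0 < (s * r).re := by simpa using mul_pos hs hr
    have ode := momA_ode hν hz
    have hs0 : s ≠ 0 := by rintro rfl; simp at hs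
    have hrc : (r : ℂ) ≠ 0 := by exact_mod_cast hr.ne'
    set a0 := momA 0 ν (s * r)
    set a1 := momA 1 ν (s * r)
    set a2 := momA 2 ν (s * r)
    have e2 : (r : ℂ) * (s * a2) = a1 + (s * r + ν ^ 2 / (s * r)) * a0 := by
      field_simp
      linear_combination ode
    have : (a1 * (starRingEnd ℂ) a0 + r * ((-s * a2) * (starRingEnd ℂ) a0
        + a1 * (starRingEnd ℂ) (-s * a1))) =
        -(s * r + ν ^ 2 / (s * r)) * ((Complex.normSq a0 : ℝ) : ℂ)
          - r * (starRingEnd ℂ) s * ((Complex.normSq a1 : ℝ) : ℂ) := by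
      rw [Complex.normSq_eq_conj_mul_self, Complex.normSq_eq_conj_mul_self, map_mul, map_neg]
      linear_combination (-(starRingEnd ℂ) a0) * e2
    have h3 := congrArg Complex.re this
    have hq : 0 ≤ (s * r + ν ^ 2 / (s * r) : ℂ).re := by
      have : ((ν : ℂ) ^ 2 / (s * r)).re = ν ^ 2 * ((s * r).re / Complex.normSq (s * r)) := by
        rw [div_eq_mul_inv, ← Complex.ofReal_pow, Complex.re_ofReal_mul, Complex.inv_re]
      rw [Complex.add_re, this]
      have := Complex.normSq_nonneg (s * r)
      positivity
    have h4 : (-(s * r + ν ^ 2 / (s * r)) * ((Complex.normSq a0 : ℝ) : ℂ)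
          - r * (starRingEnd ℂ) s * ((Complex.normSq a1 : ℝ) : ℂ)).re =
        -((s * r + ν ^ 2 / (s * r) : ℂ).re * Complex.normSq a0 +
          r * s.re * Complex.normSq a1) := by
      rw [Complex.sub_re, Complex.re_mul_ofReal, Complex.re_mul_ofReal, Complex.re_ofReal_mul,
        Complex.neg_re, Complex.conj_re]
      ring
    have h5 := Complex.normSq_nonneg a0
    have h6 := Complex.normSq_nonneg a1
    have h7 : 0 ≤ (s * r + ν ^ 2 / (s * r) : ℂ).re * Complex.normSq a0 +
          r * s.re * Complex.normSq a1 := by positivity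
    rw [h4, Complex.add_re, Complex.re_ofReal_mul] at h3
    have goal' : (a1 * (starRingEnd ℂ) a0).re + r * ((-s * a2) * (starRingEnd ℂ) a0
        + a1 * (starRingEnd ℂ) (-s * a1)).re ≤ 0 := by linarith
    simpa using goal'
  have hanti : AntitoneOn P (Set.Ioi 0) := by
    apply antitoneOn_of_deriv_nonpos (convex_Ioi 0)
    · intro r hr
      obtain ⟨d, -, h⟩ := hd r hr
      exact h.continuousAt.continuousWithinAt
    · intro r hr
      rw [interior_Ioi] at hr
      obtain ⟨d, -, h⟩ := hd r hr
      exact h.differentiableAt.differentiableWithinAt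
    · intro r hr
      rw [interior_Ioi] at hr
      obtain ⟨d, hd0, h⟩ := hd r hr
      rw [h.deriv]; exact hd0
  have hlim : Tendsto P atTop (𝓝 0) := by
    obtain ⟨C0, hC0, b0⟩ := momA_decay 0 hν hs
    obtain ⟨C1, hC1, b1⟩ := momA_decay 1 hν hs
    have hb : 0 < 2 * s.re := by positivity
    have hl : Tendsto (fun r : ℝ => C1 * C0 * (r ^ (1 : ℝ) * Real.exp (-(2 * s.re) * r)))
        atTop (𝓝 0) := by
      simpa using (tendsto_rpow_mul_exp_neg_mul_atTop_nhds_zero 1 _ hb).const_mul (C1 * C0)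
    apply squeeze_zero_norm' _ hl
    filter_upwards [eventually_ge_atTop 1] with r hr
    rw [hP, norm_mul, Real.norm_of_nonneg (by linarith), Real.rpow_one]
    have h1 : ‖(momA 1 ν (s * r) * (starRingEnd ℂ) (momA 0 ν (s * r))).re‖ ≤
        (C1 * Real.exp (-s.re * r)) * (C0 * Real.exp (-s.re * r)) := by
      refine (Complex.abs_re_le_norm _).trans ?_
      rw [norm_mul, RCLike.norm_conj]
      have := b1 r hr
      have := b0 r hr
      gcongr
    calc _ ≤ r * ((C1 * Real.exp (-s.re * r)) * (C0 * Real.exp (-s.re * r))) := by gcongr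
      _ = C1 * C0 * (r * (Real.exp (-s.re * r) * Real.exp (-s.re * r))) := by ring
      _ = _ := by rw [← Real.exp_add]; ring_nf
  have hPR : 0 ≤ P R := by
    apply le_of_tendsto hlim
    filter_upwards [eventually_ge_atTop R] with r hr
    exact hanti hR (lt_of_lt_of_le hR hr) hr
  exact nonneg_of_mul_nonneg_right hPR hR

lemma bessel_sign {ν : ℝ} (hν : 0 ≤ ν) {s : ℂ} (hs : 0 < s.re) {R : ℝ} (hR : 0 < R) :
    (besselK' ν (s * R) / besselK ν (s * R)).re ≤ 0 := by
  have h := momA_sign hν hs hR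
  have e0 : besselK ν (s * R) = momA 0 ν (s * R) := by simp [besselK, momA]
  have e1 : besselK' ν (s * R) = -momA 1 ν (s * R) := by simp [besselK', momA]
  rw [e0, e1, div_eq_mul_inv, Complex.inv_def, ← mul_assoc, Complex.re_mul_ofReal, neg_mul,
    Complex.neg_re]
  have := inv_nonneg.2 (Complex.normSq_nonneg (momA 0 ν (s * R)))
  nlinarith [mul_nonneg h this]

lemma laplace_deriv {g : ℝ → ℂ} (hg : ContDiff ℝ (⊤ : ℕ∞) g) (hc : HasCompactSupport g)
    (hsupp : tsupport g ⊆ Set.Ioi (0 : ℝ)) (s : ℂ) :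
    ∫ u in Set.Ioi (0 : ℝ), Complex.exp (-s * u) * deriv g u =
      s * ∫ u in Set.Ioi (0 : ℝ), Complex.exp (-s * u) * g u := by
  have hg1 : ContDiff ℝ 1 g := hg.of_le (by exact_mod_cast le_top)
  have hE : Continuous (fun u : ℝ => Complex.exp (-s * u)) := by fun_prop
  have i1 : Integrable (fun u : ℝ => Complex.exp (-s * u) * deriv g u) :=
    (hE.mul (hg1.continuous_deriv le_rfl)).integrable_of_hasCompactSupport hc.deriv.mul_left
  have i0 : Integrable (fun u : ℝ => -s * (Complex.exp (-s * u) * g u)) :=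
    ((hE.mul hg1.continuous).integrable_of_hasCompactSupport hc.mul_left).const_mul _
  have g0 : g 0 = 0 := by
    by_contra h
    exact lt_irrefl (0 : ℝ) (hsupp (subset_tsupport g h))
  have j : IntegrableOn (fun u : ℝ => Complex.exp (-s * u) * deriv g u +
      -s * (Complex.exp (-s * u) * g u)) (Set.Ioi 0) := (i1.add i0).integrableOn
  have key := integral_Ioi_of_hasDerivAt_of_tendsto' (a := 0) (m := (0 : ℂ))
    (f := fun u : ℝ => Complex.exp (-s * u) * g u)
    (f' := fun u : ℝ => Complex.exp (-s * u) * deriv g u + -s * (Complex.exp (-s * u) * g u))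
    ?_ j ?_
  · rw [integral_add i1.integrableOn i0.integrableOn, integral_const_mul] at key
    simp only [g0, mul_zero, sub_zero] at key
    linear_combination key
  · intro u _
    have h1 : HasDerivAt (fun u : ℝ => -s * (u : ℂ)) (-s * 1) u :=
      (Complex.ofRealCLM.hasDerivAt (x := u)).const_mul (-s)
    have h2 := h1.cexp.mul (hg1.differentiable one_ne_zero u).hasDerivAt
    refine HasDerivAt.congr_deriv h2 ?_
    ring
  · have h2 : HasCompactSupport (fun u : ℝ => Complex.exp (-s * u) * g u) := hc.mul_left
    rw [hasCompactSupport_iff_eventuallyEq, Filter.coclosedCompact_eq_cocompact] at h2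
    exact h2.filter_mono _root_.atTop_le_cocompact |>.tendsto

lemma mode_sign {s₁ R : ℝ} (hs₁ : 0 < s₁) (hR : 0 < R) (n : ℕ) {g : ℝ → ℂ}
    (hg : ContDiff ℝ (⊤ : ℕ∞) g) (hc : HasCompactSupport g)
    (hsupp : tsupport g ⊆ Set.Ioi (0 : ℝ)) (h : ℝ → ℂ)
    (hdef : ∀ t : ℝ, h t =
      (1 / (2 * Real.pi) : ℝ) • (Real.exp (s₁ * t) •
        ∫ s₂ : ℝ, Complex.exp (s₂ * t * Complex.I) *
          (((s₁ : ℂ) + s₂ * Complex.I) *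
            (besselK' (n : ℝ) (((s₁ : ℂ) + s₂ * Complex.I) * R) /
              besselK (n : ℝ) (((s₁ : ℂ) + s₂ * Complex.I) * R))) *
          ∫ u in Set.Ioi (0 : ℝ),
            Complex.exp (-((s₁ : ℂ) + s₂ * Complex.I) * u) * g u)) :
    (∫ t in Set.Ioi (0 : ℝ),
          Real.exp (-2 * s₁ * t) • (h t * (starRingEnd ℂ) (deriv g t))).re ≤ 0 := by
  have hg1 : ContDiff ℝ 1 g := hg.of_le (by exact_mod_cast le_top)
  set m : ℝ → ℂ := fun s₂ => besselK' (n : ℝ) (((s₁ : ℂ) + s₂ * Complex.I) * R) /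
              besselK (n : ℝ) (((s₁ : ℂ) + s₂ * Complex.I) * R) with hm
  set L : ℝ → ℂ := fun s₂ => ∫ u in Set.Ioi (0 : ℝ),
            Complex.exp (-((s₁ : ℂ) + s₂ * Complex.I) * u) * g u with hL
  set F : ℝ → ℂ := fun s₂ => (((s₁ : ℂ) + s₂ * Complex.I) * m s₂) * L s₂ with hF
  have hdef' : ∀ t : ℝ, h t = (1 / (2 * Real.pi) : ℝ) • (Real.exp (s₁ * t) •
        ∫ s₂ : ℝ, Complex.exp (s₂ * t * Complex.I) * F s₂) := by
    intro t
    rw [hdef t]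
    simp only [hF, hm, hL, mul_assoc]
  have hunit : ∀ a b : ℝ, ‖Complex.exp (a * b * Complex.I)‖ = 1 := by
    intro a b
    rw [← Complex.ofReal_mul]
    exact Complex.norm_exp_ofReal_mul_I _
  by_cases hFi : Integrable F
  · set c : ℝ → ℂ := fun t => (Real.exp (-s₁ * t) : ℂ) * (starRingEnd ℂ) (deriv g t) with hcdef
    have hccont : Continuous c := by
      have := hg1.continuous_deriv le_rfl
      have h2 : Continuous (fun t => (starRingEnd ℂ) (deriv g t)) :=
        Complex.continuous_conj.comp this
      fun_prop
    have hcc : HasCompactSupport c := by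
      apply HasCompactSupport.mul_left
      exact hc.deriv.comp_left (g := starRingEnd ℂ) (map_zero _)
    have hci : Integrable c := hccont.integrable_of_hasCompactSupport hcc
    have hprod : Integrable (Function.uncurry fun (t s₂ : ℝ) =>
        Complex.exp (s₂ * t * Complex.I) * (c t * F s₂))
        ((volume.restrict (Set.Ioi (0 : ℝ))).prod volume) := by
      have h1 := (hci.integrableOn (s := Set.Ioi (0 : ℝ))).mul_prod hFi
      apply h1.bdd_mul (c := 1) (f := fun p : ℝ × ℝ => Complex.exp (p.2 * p.1 * Complex.I))
      · exact (by fun_prop : Continuous fun p : ℝ × ℝ =>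
          Complex.exp (p.2 * p.1 * Complex.I)).aestronglyMeasurable
      · filter_upwards with p
        exact (hunit _ _).le
    have e1 : ∫ t in Set.Ioi (0 : ℝ), Real.exp (-2 * s₁ * t) • (h t * (starRingEnd ℂ) (deriv g t))
        = ((1 / (2 * Real.pi) : ℝ) : ℂ) * ∫ t in Set.Ioi (0 : ℝ), ∫ s₂ : ℝ,
          Complex.exp (s₂ * t * Complex.I) * (c t * F s₂) := by
      rw [← integral_const_mul]
      congr 1
      ext t
      have : ∫ s₂ : ℝ, Complex.exp (s₂ * t * Complex.I) * (c t * F s₂) =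
          c t * ∫ s₂ : ℝ, Complex.exp (s₂ * t * Complex.I) * F s₂ := by
        rw [← integral_const_mul]
        congr 1
        ext s₂
        ring
      rw [this, hdef' t]
      simp only [Complex.real_smul, hcdef]
      have he : (Real.exp (-s₁ * t) : ℂ) = Real.exp (-2 * s₁ * t) * Real.exp (s₁ * t) := by
        rw [← Complex.ofReal_mul, ← Real.exp_add]
        congr 2
        ring
      rw [he]
      ring
    have e2 : ∀ s₂ : ℝ, ∫ t in Set.Ioi (0 : ℝ), Complex.exp (s₂ * t * Complex.I) * (c t * F s₂) =
        m s₂ * ((Complex.normSq (((s₁ : ℂ) + s₂ * Complex.I) * L s₂) : ℝ) : ℂ) := by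
      intro s₂
      have hl := laplace_deriv hg hc hsupp ((s₁ : ℂ) + s₂ * Complex.I)
      have : ∫ t in Set.Ioi (0 : ℝ), Complex.exp (s₂ * t * Complex.I) * (c t * F s₂) =
          F s₂ * (starRingEnd ℂ) (∫ u in Set.Ioi (0 : ℝ),
            Complex.exp (-((s₁ : ℂ) + s₂ * Complex.I) * u) * deriv g u) := by
        rw [← integral_conj, ← integral_const_mul]
        congr 1
        ext t
        simp only [hcdef, map_mul, ← Complex.exp_conj, map_neg, map_add, Complex.conj_ofReal,
          Complex.conj_I]
        have : Complex.exp (-((s₁ : ℂ) + s₂ * -Complex.I) * t) =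
            Complex.exp (s₂ * t * Complex.I) * (Real.exp (-s₁ * t) : ℂ) := by
          push_cast
          rw [← Complex.exp_add]
          congr 1
          ring
        rw [this]
        ring
      rw [this, hl, Complex.normSq_eq_conj_mul_self]
      simp only [hF, hL]
      ring
    rw [e1, integral_integral_swap hprod, Complex.re_ofReal_mul]
    have hre : (∫ s₂ : ℝ, ∫ t in Set.Ioi (0 : ℝ),
        Complex.exp (s₂ * t * Complex.I) * (c t * F s₂)).re ≤ 0 := by
      have hI := hprod.integral_prod_right
      have hr := integral_re (𝕜 := ℂ) hI
      simp only [RCLike.re_to_complex, Function.uncurry_apply_pair] at hr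
      rw [← hr]
      apply integral_nonpos
      intro s₂
      simp only [Pi.zero_apply]
      rw [e2, Complex.re_mul_ofReal]
      apply mul_nonpos_of_nonpos_of_nonneg _ (Complex.normSq_nonneg _)
      exact bessel_sign (Nat.cast_nonneg n) (by simpa using hs₁) hR
    exact mul_nonpos_of_nonneg_of_nonpos (by positivity) hre
  · have h0 : ∀ t, h t = 0 := by
      intro t
      rw [hdef' t, integral_undef, smul_zero, smul_zero]
      intro hi
      apply hFi
      have h2 := hi.bdd_mul (c := 1) (f := fun s₂ : ℝ => Complex.exp (s₂ * (-t : ℝ) * Complex.I))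
        (by fun_prop : Continuous fun s₂ : ℝ =>
          Complex.exp (s₂ * (-t : ℝ) * Complex.I)).aestronglyMeasurable
        (by filter_upwards with s₂; exact (hunit _ _).le)
      refine h2.congr ?_
      filter_upwards with s₂
      rw [← mul_assoc, ← Complex.exp_add]
      have : (s₂ : ℂ) * (-t : ℝ) * Complex.I + s₂ * t * Complex.I = 0 := by push_cast; ring
      rw [this, Complex.exp_zero, one_mul]
    simp [h0]

end

/-- Fourier-coefficient form of the paper's Lemma 2.4: the time-domain DtN operator acts
mode-wise by the Laplace-domain multiplier `s K_n'(sR)/K_n(sR)`; for smooth data `g_n`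
compactly supported in `(0,∞)`, with
`h_n(t) = (1/2π) e^{s₁ t} ∫_ℝ e^{i s₂ t} s (K_n'(sR)/K_n(sR)) g_{n,L}(s) ds₂`
(`s = s₁ + i s₂`, `g_{n,L}(s) = ∫₀^∞ e^{-s u} g_n(u) du`), one has
`Re Σ_{n=1}^N ∫₀^∞ e^{-2 s₁ t} h_n(t) conj(g_n'(t)) dt ≤ 0`. -/
theorem dtn_time_domain_sign (s₁ R : ℝ) (hs₁ : 0 < s₁) (hR : 0 < R)
    (N : ℕ) (hN : 1 ≤ N) (g : ℕ → ℝ → ℂ)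
    (hg_smooth : ∀ n ∈ Finset.Icc 1 N, ContDiff ℝ (⊤ : ℕ∞) (g n))
    (hg_cpt : ∀ n ∈ Finset.Icc 1 N, HasCompactSupport (g n))
    (hg_supp : ∀ n ∈ Finset.Icc 1 N, tsupport (g n) ⊆ Set.Ioi (0 : ℝ))
    (h : ℕ → ℝ → ℂ)
    (hdef : ∀ n ∈ Finset.Icc 1 N, ∀ t : ℝ, h n t =
      (1 / (2 * Real.pi) : ℝ) • (Real.exp (s₁ * t) •
        ∫ s₂ : ℝ, Complex.exp (s₂ * t * Complex.I) *
          (((s₁ : ℂ) + s₂ * Complex.I) *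
            (besselK' (n : ℝ) (((s₁ : ℂ) + s₂ * Complex.I) * R) /
              besselK (n : ℝ) (((s₁ : ℂ) + s₂ * Complex.I) * R))) *
          ∫ u in Set.Ioi (0 : ℝ),
            Complex.exp (-((s₁ : ℂ) + s₂ * Complex.I) * u) * g n u)) :
    (∑ n ∈ Finset.Icc 1 N,
        ∫ t in Set.Ioi (0 : ℝ),
          Real.exp (-2 * s₁ * t) • (h n t * (starRingEnd ℂ) (deriv (g n) t))).re ≤ 0 := by
  rw [Complex.re_sum]
  apply Finset.sum_nonpos
  intro n hn
  exact mode_sign hs₁ hR n (hg_smooth n hn) (hg_cpt n hn) (hg_supp n hn) (h n) (hdef n hn)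
end
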